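/- arXiv:1603.07164 — 8 statements merged into one kernel-verified Lean document; each statement's English description precedes it below -/
import Mathlib

section
/- Assume the kernel satisfies (M1) and (M2). Let u : [τ,T] → E be Lipschitz continuous with almost-everywhere derivative u̇ satisfying ‖u̇(t)‖_E ≤ L for a.e. t, and let η_τ : (0,∞) → E be locally absolutely continuous with derivative η_τ′ satisfying ‖η_τ′‖_{M_τ} < ∞. For t ∈ [τ,T] define ζ^t : (0,∞) → E by ζ^t(s) = u̇(t−s) for 0 < s < t−τ and ζ^t(s) = η_τ′(s−t+τ) for s > t−τ (this is the a.e. s-derivative of the function η^t given by the representation formula). Then for every t ∈ [τ,T]: ‖ζ^t‖²_{M_τ} ≤ κ(τ) L² + ‖η_τ′‖²_{M_τ}, and consequently ‖ζ^t‖²_{M_t} ≤ (κ(τ) L² + ‖η_τ′‖²_{M_τ}) · K_τ(t). -/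
open MeasureTheory Set Filter

/-- A function that is almost everywhere the derivative of some function of a real variable is
almost everywhere strongly measurable. -/
theorem aestronglyMeasurable_of_ae_hasDerivAt {E : Type*} [NormedAddCommGroup E]
    [NormedSpace ℝ E] [CompleteSpace E] {ν : Measure ℝ} {u u' : ℝ → E}
    (hu' : ∀ᵐ t ∂ν, HasDerivAt u (u' t) t) : AEStronglyMeasurable u' ν :=
  (aestronglyMeasurable_deriv u ν).congr (hu'.mono fun _ ht => ht.deriv)

theorem measurePreserving_const_sub_Ioo (t a : ℝ) :
    MeasurePreserving (fun s : ℝ => t - s) (volume.restrict (Ioo 0 (t - a)))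
      (volume.restrict (Ioo a t)) := by
  have h := (Measure.measurePreserving_sub_left (volume : Measure ℝ) t).restrict_preimage
    (measurableSet_Ioo (a := a) (b := t))
  simpa using h

theorem measurePreserving_sub_const_Ioi (a : ℝ) :
    MeasurePreserving (fun s : ℝ => s - a) (volume.restrict (Ioi a))
      (volume.restrict (Ioi 0)) := by
  have h := (measurePreserving_sub_right (volume : Measure ℝ) a).restrict_preimage
    (measurableSet_Ioi (a := (0 : ℝ)))
  simpa using h

/-- Splitting a weighted integral over `(0, ∞)` at `a`: the part below `a` is controlled by a
uniform bound, the part above `a` is a translate whose weight has decreased. -/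
theorem integrableOn_and_setIntegral_le_of_split {w f h : ℝ → ℝ} {a C : ℝ} (ha : 0 ≤ a)
    (hC : 0 ≤ C) (hw : ∀ s ∈ Ioi (0 : ℝ), 0 < w s) (hmono : AntitoneOn w (Ioi 0))
    (hint : IntegrableOn w (Ioi 0)) (hf0 : ∀ s, 0 ≤ f s)
    (hf : AEStronglyMeasurable f (volume.restrict (Ioi 0)))
    (hwh : IntegrableOn (fun s => w s * h s) (Ioi 0))
    (hlow : ∀ᵐ s ∂(volume.restrict (Ioo 0 a)), f s ≤ C)
    (hhigh : ∀ s ∈ Ioi a, f s = h (s - a)) :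
    IntegrableOn (fun s => w s * f s) (Ioi 0) ∧
      (∫ s in Ioi (0 : ℝ), w s * f s) ≤
        (∫ s in Ioi (0 : ℝ), w s) * C + ∫ s in Ioi (0 : ℝ), w s * h s := by
  set G : ℝ → ℝ := fun s => w s * h s with hG
  set D : ℝ → ℝ := fun s => w s * C + (Ioi a).indicator (fun s => G (s - a)) s with hD
  have hpres := measurePreserving_sub_const_Ioi a
  have hemb : MeasurableEmbedding (fun s : ℝ => s - a) := measurableEmbedding_subRight a
  have hGa : IntegrableOn (fun s => G (s - a)) (Ioi a) :=
    (hpres.integrable_comp_emb hemb).2 hwh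
  have hGa' : IntegrableOn ((Ioi a).indicator (fun s => G (s - a))) (Ioi 0) :=
    ((integrable_indicator_iff measurableSet_Ioi).2 hGa).integrableOn
  have hDint : IntegrableOn D (Ioi 0) := (hint.mul_const C).add hGa'
  have hle : ∀ᵐ s ∂(volume.restrict (Ioi 0)), w s * f s ≤ D s := by
    rw [← Ioc_union_Ioi_eq_Ioi ha, ae_restrict_union_iff, ← Measure.restrict_congr_set Ioo_ae_eq_Ioc]
    constructor
    · filter_upwards [hlow, ae_restrict_mem measurableSet_Ioo] with s hs hmem
      have hna : s ∉ Ioi a := not_lt.2 hmem.2.le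
      simpa [hD, hna] using mul_le_mul_of_nonneg_left hs (hw s hmem.1).le
    · filter_upwards [ae_restrict_mem measurableSet_Ioi] with s (hs : a < s)
      have hs0 : 0 < s := ha.trans_lt hs
      have hsa : 0 < s - a := sub_pos.2 hs
      have hDs : D s = w s * C + w (s - a) * f s := by
        simp [hD, hG, hs, hhigh s hs]
      rw [hDs]
      have := mul_le_mul_of_nonneg_right
        (hmono (mem_Ioi.2 hsa) (mem_Ioi.2 hs0) (by linarith)) (hf0 s)
      have := mul_nonneg (hw s hs0).le hC
      linarith
  have hFint : IntegrableOn (fun s => w s * f s) (Ioi 0) := by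
    refine hDint.mono' (hint.aestronglyMeasurable.mul hf) ?_
    filter_upwards [hle, ae_restrict_mem measurableSet_Ioi] with s hs hmem
    rwa [Real.norm_of_nonneg (mul_nonneg (hw s hmem).le (hf0 s))]
  refine ⟨hFint, (integral_mono_ae hFint hDint hle).trans_eq ?_⟩
  rw [hD, integral_add (hint.mul_const C) hGa', integral_mul_const,
    setIntegral_indicator measurableSet_Ioi, Ioi_inter_Ioi, sup_eq_right.2 ha,
    hpres.integral_comp hemb G]

/-- Bound on the `s`-derivative `ζ` of the history variable (estimate (5.4)/(5.5)
of the paper), under (M1)-(M2), for `u` Lipschitz with a.e. derivative bounded by `L`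
and `ητ` locally absolutely continuous with derivative of finite `M_τ`-norm. -/
theorem memory_eta_derivative_bound
    {E : Type*} [NormedAddCommGroup E] [InnerProductSpace ℝ E] [CompleteSpace E]
    (τ T : ℝ) (hτT : τ < T)
    (μ : ℝ → ℝ → ℝ) (K : ℝ → ℝ)
    -- the kernel is positive
    (hμpos : ∀ t : ℝ, ∀ s ∈ Ioi (0:ℝ), 0 < μ t s)
    -- (M1): for each t, s ↦ μ t s is nonincreasing, locally absolutely continuous
    -- and integrable on (0,∞)
    (hM1mono : ∀ t : ℝ, AntitoneOn (μ t) (Ioi 0))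
    (hM1ac : ∀ t : ℝ, ∃ g : ℝ → ℝ, ∀ p ∈ Ioi (0:ℝ), ∀ q ∈ Ioi (0:ℝ), p ≤ q →
      μ t q - μ t p = ∫ s in p..q, g s)
    (hM1int : ∀ t : ℝ, IntegrableOn (μ t) (Ioi 0))
    -- (M2): μ t s ≤ K t * μ τ s for t ≥ τ, with K positive and locally integrable
    (hKpos : ∀ t ∈ Ici τ, 0 < K t)
    (hKint : ∀ r : ℝ, IntegrableOn K (Icc τ r))
    (hM2 : ∀ t ∈ Ici τ, ∀ s ∈ Ioi (0:ℝ), μ t s ≤ K t * μ τ s)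
    -- u is Lipschitz on [τ,T] with a.e. derivative u' bounded by L
    (u u' : ℝ → E) (L : ℝ) (hL : 0 ≤ L) (Lip : NNReal)
    (huLip : LipschitzOnWith Lip u (Icc τ T))
    (hu' : ∀ᵐ t ∂(volume.restrict (Icc τ T)), HasDerivAt u (u' t) t)
    (hu'bdd : ∀ᵐ t ∂(volume.restrict (Icc τ T)), ‖u' t‖ ≤ L)
    -- ητ is locally absolutely continuous on (0,∞) with derivative ητ' of finite M_τ-norm
    (ητ ητ' : ℝ → E)
    (hητac : ∀ p ∈ Ioi (0:ℝ), ∀ q ∈ Ioi (0:ℝ), p ≤ q →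
      ητ q - ητ p = ∫ s in p..q, ητ' s)
    (hητ' : IntegrableOn (fun s => μ τ s * ‖ητ' s‖ ^ 2) (Ioi 0))
    -- the a.e. s-derivative ζ of the history variable given by the representation formula
    (ζ : ℝ → ℝ → E)
    (hζ : ∀ t ∈ Icc τ T, ∀ s ∈ Ioi (0:ℝ),
      ζ t s = if s < t - τ then u' (t - s) else ητ' (s - t + τ)) :
    ∀ t ∈ Icc τ T,
      IntegrableOn (fun s => μ τ s * ‖ζ t s‖ ^ 2) (Ioi 0)
      ∧ (∫ s in Ioi (0:ℝ), μ τ s * ‖ζ t s‖ ^ 2)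
          ≤ (∫ s in Ioi (0:ℝ), μ τ s) * L ^ 2 + ∫ s in Ioi (0:ℝ), μ τ s * ‖ητ' s‖ ^ 2
      ∧ IntegrableOn (fun s => μ t s * ‖ζ t s‖ ^ 2) (Ioi 0)
      ∧ (∫ s in Ioi (0:ℝ), μ t s * ‖ζ t s‖ ^ 2)
          ≤ ((∫ s in Ioi (0:ℝ), μ τ s) * L ^ 2 + ∫ s in Ioi (0:ℝ), μ τ s * ‖ητ' s‖ ^ 2)
              * K t := by
  intro t ht
  have ha : 0 ≤ t - τ := sub_nonneg.2 ht.1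
  have hsub : Ioo τ t ⊆ Icc τ T := fun x hx => ⟨hx.1.le, hx.2.le.trans ht.2⟩
  have hpres := measurePreserving_const_sub_Ioo t τ
  have hlow : ∀ s ∈ Ioo 0 (t - τ), ζ t s = u' (t - s) := fun s hs => by
    rw [hζ t ht s hs.1, if_pos hs.2]
  have hhigh : ∀ s ∈ Ioi (t - τ), ζ t s = ητ' (s - (t - τ)) := fun s hs => by
    rw [hζ t ht s (ha.trans_lt hs), if_neg (not_lt.2 (le_of_lt hs)), sub_sub_eq_add_sub,
      sub_add_eq_add_sub]
  have hu'meas : AEStronglyMeasurable u' (volume.restrict (Ioo τ t)) :=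
    (aestronglyMeasurable_of_ae_hasDerivAt hu').mono_set hsub
  have hημeas : AEStronglyMeasurable (fun s => ‖ητ' s‖ ^ 2) (volume.restrict (Ioi 0)) := by
    refine (hητ'.aestronglyMeasurable.aemeasurable.div
      (hM1int τ).aestronglyMeasurable.aemeasurable).aestronglyMeasurable.congr ?_
    filter_upwards [ae_restrict_mem measurableSet_Ioi] with s hs
    exact mul_div_cancel_left₀ _ (hμpos τ s hs).ne'
  have hmeas : AEStronglyMeasurable (fun s => ‖ζ t s‖ ^ 2) (volume.restrict (Ioi 0)) := by
    rw [← Ioc_union_Ioi_eq_Ioi ha, aestronglyMeasurable_union_iff, ← Measure.restrict_congr_set Ioo_ae_eq_Ioc]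
    constructor
    · refine ((hu'meas.comp_measurePreserving hpres).norm.pow 2).congr ?_
      filter_upwards [ae_restrict_mem measurableSet_Ioo] with s hs
      simp [hlow s hs]
    · refine (hημeas.comp_measurePreserving
        (measurePreserving_sub_const_Ioi (t - τ))).congr ?_
      filter_upwards [ae_restrict_mem measurableSet_Ioi] with s hs
      simp [hhigh s hs]
  have hbdd : ∀ᵐ s ∂(volume.restrict (Ioo 0 (t - τ))), ‖ζ t s‖ ^ 2 ≤ L ^ 2 := by
    filter_upwards [hpres.quasiMeasurePreserving.ae
        (ae_restrict_of_ae_restrict_of_subset hsub hu'bdd),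
      ae_restrict_mem measurableSet_Ioo] with s hs hmem
    rw [hlow s hmem]
    exact pow_le_pow_left₀ (norm_nonneg _) hs 2
  obtain ⟨hint, hle⟩ := integrableOn_and_setIntegral_le_of_split ha (sq_nonneg L) (hμpos τ)
    (hM1mono τ) (hM1int τ) (fun s => sq_nonneg ‖ζ t s‖) hmeas hητ' hbdd
    (fun s hs => by rw [hhigh s hs])
  have hcmp : ∀ᵐ s ∂(volume.restrict (Ioi 0)),
      μ t s * ‖ζ t s‖ ^ 2 ≤ μ τ s * ‖ζ t s‖ ^ 2 * K t := by
    filter_upwards [ae_restrict_mem measurableSet_Ioi] with s hs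
    calc μ t s * ‖ζ t s‖ ^ 2 ≤ K t * μ τ s * ‖ζ t s‖ ^ 2 :=
          mul_le_mul_of_nonneg_right (hM2 t ht.1 s hs) (sq_nonneg _)
      _ = μ τ s * ‖ζ t s‖ ^ 2 * K t := by ring
  have hint_t : IntegrableOn (fun s => μ t s * ‖ζ t s‖ ^ 2) (Ioi 0) := by
    refine (hint.mul_const (K t)).mono' ((hM1int t).aestronglyMeasurable.mul hmeas) ?_
    filter_upwards [hcmp, ae_restrict_mem measurableSet_Ioi] with s hs hmem
    rwa [Real.norm_of_nonneg (mul_nonneg (hμpos t s hmem).le (sq_nonneg _))]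
  refine ⟨hint, hle, hint_t, (integral_mono_ae hint_t (hint.mul_const (K t)) hcmp).trans ?_⟩
  rw [integral_mul_const]
  exact mul_le_mul_of_nonneg_right hle (hKpos t ht.1).le
end

section
/- For every t ∈ ℝ and every s > 0, the partial derivatives of the rescaled kernel exist, are given by ∂_s μ_t(s) = ε(t)⁻³ μ′(s/ε(t)) and ∂_t μ_t(s) = −(ε′(t)/ε(t)) [2 μ_t(s) + s ∂_s μ_t(s)], and satisfy the inequality ∂_t μ_t(s) + ∂_s μ_t(s) ≤ −2 (ε′(t)/ε(t)) · μ_t(s); that is, the rescaled kernel satisfies assumption (M4) with M(t) = −2 ε′(t)/ε(t). -/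
open MeasureTheory Set Filter

/-- The rescaled kernel `μ_t(s) = ε(t)⁻² μ(s/ε(t))` has partial derivatives
`∂ₛμ_t(s) = ε(t)⁻³ μ'(s/ε(t))` and
`∂ₜμ_t(s) = −(ε'(t)/ε(t))·[2 μ_t(s) + s ∂ₛμ_t(s)]`, and satisfies assumption (M4)
with `M(t) = −2 ε'(t)/ε(t)`. -/
theorem rescaled_kernel_M4
    (μ ε : ℝ → ℝ)
    (hμ0 : ∀ s ∈ Ioi (0:ℝ), 0 ≤ μ s)
    (hμmono : AntitoneOn μ (Ioi 0))
    (hμC1 : ContDiffOn ℝ 1 μ (Ioi 0))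
    (hμint : IntegrableOn μ (Ioi 0))
    (hεpos : ∀ t : ℝ, 0 < ε t)
    (hεC1 : ContDiff ℝ 1 ε)
    (hε' : ∀ t : ℝ, deriv ε t ≤ 0)
    (t s : ℝ) (hs : 0 < s) :
    HasDerivAt (fun σ => (1 / (ε t) ^ 2) * μ (σ / ε t))
        ((1 / (ε t) ^ 3) * deriv μ (s / ε t)) s
    ∧ HasDerivAt (fun r => (1 / (ε r) ^ 2) * μ (s / ε r))
        (-(deriv ε t / ε t) *
          (2 * ((1 / (ε t) ^ 2) * μ (s / ε t))
            + s * ((1 / (ε t) ^ 3) * deriv μ (s / ε t)))) t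
    ∧ (-(deriv ε t / ε t) *
          (2 * ((1 / (ε t) ^ 2) * μ (s / ε t))
            + s * ((1 / (ε t) ^ 3) * deriv μ (s / ε t))))
        + (1 / (ε t) ^ 3) * deriv μ (s / ε t)
      ≤ -2 * (deriv ε t / ε t) * ((1 / (ε t) ^ 2) * μ (s / ε t)) := by
  have hε : ε t ≠ 0 := (hεpos t).ne'
  have hx : s / ε t ∈ Ioi (0:ℝ) := div_pos hs (hεpos t)
  have hμ : HasDerivAt μ (deriv μ (s / ε t)) (s / ε t) :=
    ((hμC1.differentiableOn one_ne_zero).differentiableAt (Ioi_mem_nhds hx)).hasDerivAt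
  have hεd : HasDerivAt ε (deriv ε t) t :=
    (hεC1.differentiable one_ne_zero t).hasDerivAt
  have hμ' : deriv μ (s / ε t) ≤ 0 := by
    rw [← derivWithin_of_isOpen isOpen_Ioi hx]
    exact hμmono.derivWithin_nonpos
  refine ⟨?_, ?_, ?_⟩
  · have hquot : HasDerivAt (fun σ => σ / ε t) (1 / ε t) s := (hasDerivAt_id s).div_const (ε t)
    refine ((hμ.comp s hquot).const_mul (1 / (ε t) ^ 2)).congr_deriv ?_
    field_simp
  · have hquot : HasDerivAt (fun r => s / ε r) ((0 * ε t - s * deriv ε t) / (ε t) ^ 2) t :=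
      (hasDerivAt_const t s).fun_div hεd hε
    have hcoef : HasDerivAt (fun r => 1 / (ε r) ^ 2) _ t :=
      (hasDerivAt_const t (1:ℝ)).fun_div (hεd.fun_pow 2) (pow_ne_zero 2 hε)
    refine (hcoef.fun_mul (hμ.comp t hquot)).congr_deriv ?_
    simp only [Function.comp_apply]
    field_simp
    ring
  · have hM : 0 ≤ -(deriv ε t / ε t) :=
      neg_nonneg.mpr (div_nonpos_of_nonpos_of_nonneg (hε' t) (hεpos t).le)
    have hdμ : (1 / (ε t) ^ 3) * deriv μ (s / ε t) ≤ 0 :=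
      mul_nonpos_of_nonneg_of_nonpos (one_div_nonneg.mpr (pow_pos (hεpos t) 3).le) hμ'
    have hsdμ := mul_nonpos_of_nonneg_of_nonpos (mul_nonneg hM hs.le) hdμ
    linarith
end

section
/- For every τ ≤ t and every s > 0 one has μ_t(s) ≤ (K₀(t)² / (β K₀(τ))) · μ_τ(s); that is, the kernel μ_t satisfies assumption (M2) with K_τ(t) = K₀(t)²/(β K₀(τ)). -/
open MeasureTheory Set Filter

/-- The aging viscoelasticity kernel
`μ_t(s) = (ργ)⁻¹ K₀(t) K₀(t−s) exp(−γ⁻¹ ∫₀ˢ K₀(t−y) dy)` satisfies assumption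
(M2) with `K_τ(t) = K₀(t)²/(β K₀(τ))`. -/
theorem aging_kernel_M2
    (ρ γ β : ℝ) (hρ : 0 < ρ) (hγ : 0 < γ) (hβ : 0 < β)
    (K₀ : ℝ → ℝ) (hK₀C1 : ContDiff ℝ 1 K₀) (hK₀mono : Monotone K₀)
    (hK₀β : ∀ t : ℝ, β ≤ K₀ t)
    (τ t : ℝ) (hτt : τ ≤ t) (s : ℝ) (hs : 0 < s) :
    (ρ * γ)⁻¹ * K₀ t * K₀ (t - s) * Real.exp (-γ⁻¹ * ∫ y in (0:ℝ)..s, K₀ (t - y))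
      ≤ ((K₀ t) ^ 2 / (β * K₀ τ)) *
          ((ρ * γ)⁻¹ * K₀ τ * K₀ (τ - s)
            * Real.exp (-γ⁻¹ * ∫ y in (0:ℝ)..s, K₀ (τ - y))) := by
  have hpos : ∀ x, 0 < K₀ x := fun x => hβ.trans_le (hK₀β x)
  have hint : ∀ x, IntervalIntegrable (fun y => K₀ (x - y)) volume 0 s := fun x =>
    (hK₀C1.continuous.comp (continuous_const.sub continuous_id)).intervalIntegrable 0 s
  have hI : (∫ y in (0:ℝ)..s, K₀ (τ - y)) ≤ ∫ y in (0:ℝ)..s, K₀ (t - y) :=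
    intervalIntegral.integral_mono_on hs.le (hint τ) (hint t)
      fun y _ => hK₀mono (sub_le_sub_right hτt y)
  have hexp : Real.exp (-γ⁻¹ * ∫ y in (0:ℝ)..s, K₀ (t - y))
      ≤ Real.exp (-γ⁻¹ * ∫ y in (0:ℝ)..s, K₀ (τ - y)) :=
    Real.exp_le_exp.2 (mul_le_mul_of_nonpos_left hI (neg_nonpos.2 (inv_nonneg.2 hγ.le)))
  have hKs : K₀ (t - s) ≤ K₀ t * (K₀ (τ - s) / β) :=
    (hK₀mono (sub_le_self t hs.le)).trans
      (le_mul_of_one_le_right (hpos t).le ((one_le_div hβ).2 (hK₀β (τ - s))))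
  have hc : 0 ≤ (ρ * γ)⁻¹ * K₀ t := mul_nonneg (inv_nonneg.2 (mul_pos hρ hγ).le) (hpos t).le
  calc
    _ ≤ (ρ * γ)⁻¹ * K₀ t * (K₀ t * (K₀ (τ - s) / β))
          * Real.exp (-γ⁻¹ * ∫ y in (0:ℝ)..s, K₀ (τ - y)) :=
      mul_le_mul (mul_le_mul_of_nonneg_left hKs hc) hexp (Real.exp_nonneg _)
        (mul_nonneg hc ((hpos (t - s)).le.trans hKs))
    _ = _ := by
      have := (hpos τ).ne'
      field_simp
end

section
/- For every t ∈ ℝ and every s > 0, the partial derivatives of μ_t exist and satisfy ∂_t μ_t(s) + ∂_s μ_t(s) = (ργ)⁻¹ [K₀′(t) − γ⁻¹ K₀(t)²] K₀(t−s) exp(−γ⁻¹ ∫_0^s K₀(t−y) dy) ≤ (K₀′(t)/K₀(t)) · μ_t(s); that is, the kernel μ_t satisfies assumption (M4) with M(t) = K₀′(t)/K₀(t). -/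
open MeasureTheory Set Filter

/-- A delayed integral of a continuous function is a difference of values of its primitive. -/
lemma integral_sub_left_eq_primitive_sub {f : ℝ → ℝ} (hf : Continuous f) (r σ : ℝ) :
    ∫ y in (0:ℝ)..σ, f (r - y) = (∫ x in (0:ℝ)..r, f x) - ∫ x in (0:ℝ)..(r - σ), f x := by
  rw [intervalIntegral.integral_comp_sub_left f r, sub_zero]
  exact (intervalIntegral.integral_interval_sub_left
    (hf.intervalIntegrable _ _) (hf.intervalIntegrable _ _)).symm

/-- Derivative of a delayed integral in the current time. -/
lemma hasDerivAt_integral_sub_left {f : ℝ → ℝ} (hf : Continuous f) (t s : ℝ) :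
    HasDerivAt (fun r => ∫ y in (0:ℝ)..s, f (r - y)) (f t - f (t - s)) t := by
  simp_rw [integral_sub_left_eq_primitive_sub hf]
  exact (hf.integral_hasStrictDerivAt 0 t).hasDerivAt.sub
    ((hf.integral_hasStrictDerivAt 0 (t - s)).hasDerivAt.comp_sub_const t s)

/-- The aging viscoelasticity kernel
`μ_t(s) = (ργ)⁻¹ K₀(t) K₀(t−s) exp(−γ⁻¹ ∫₀ˢ K₀(t−y) dy)` has partial derivatives
in `t` and in `s`, whose sum equals
`(ργ)⁻¹ [K₀'(t) − γ⁻¹ K₀(t)²] K₀(t−s) exp(−γ⁻¹ ∫₀ˢ K₀(t−y) dy)` and is bounded by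
`(K₀'(t)/K₀(t))·μ_t(s)`; i.e. (M4) holds with `M(t) = K₀'(t)/K₀(t)`. -/
theorem aging_kernel_M4
    (ρ γ β : ℝ) (hρ : 0 < ρ) (hγ : 0 < γ) (hβ : 0 < β)
    (K₀ : ℝ → ℝ) (hK₀C1 : ContDiff ℝ 1 K₀) (hK₀mono : Monotone K₀)
    (hK₀β : ∀ t : ℝ, β ≤ K₀ t)
    (t s : ℝ) (hs : 0 < s) :
    DifferentiableAt ℝ
      (fun r => (ρ * γ)⁻¹ * K₀ r * K₀ (r - s)
        * Real.exp (-γ⁻¹ * ∫ y in (0:ℝ)..s, K₀ (r - y))) t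
    ∧ DifferentiableAt ℝ
      (fun σ => (ρ * γ)⁻¹ * K₀ t * K₀ (t - σ)
        * Real.exp (-γ⁻¹ * ∫ y in (0:ℝ)..σ, K₀ (t - y))) s
    ∧ deriv (fun r => (ρ * γ)⁻¹ * K₀ r * K₀ (r - s)
          * Real.exp (-γ⁻¹ * ∫ y in (0:ℝ)..s, K₀ (r - y))) t
        + deriv (fun σ => (ρ * γ)⁻¹ * K₀ t * K₀ (t - σ)
          * Real.exp (-γ⁻¹ * ∫ y in (0:ℝ)..σ, K₀ (t - y))) s
      = (ρ * γ)⁻¹ * (deriv K₀ t - γ⁻¹ * (K₀ t) ^ 2) * K₀ (t - s)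
          * Real.exp (-γ⁻¹ * ∫ y in (0:ℝ)..s, K₀ (t - y))
    ∧ (ρ * γ)⁻¹ * (deriv K₀ t - γ⁻¹ * (K₀ t) ^ 2) * K₀ (t - s)
          * Real.exp (-γ⁻¹ * ∫ y in (0:ℝ)..s, K₀ (t - y))
      ≤ (deriv K₀ t / K₀ t) *
          ((ρ * γ)⁻¹ * K₀ t * K₀ (t - s)
            * Real.exp (-γ⁻¹ * ∫ y in (0:ℝ)..s, K₀ (t - y))) := by
  have hcont : Continuous K₀ := hK₀C1.continuous
  have hderiv : ∀ x, HasDerivAt K₀ (deriv K₀ x) x := fun x =>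
    (hK₀C1.differentiable one_ne_zero x).hasDerivAt
  have hpos : ∀ x, 0 < K₀ x := fun x => hβ.trans_le (hK₀β x)
  have hr := (((hderiv t).const_mul (ρ * γ)⁻¹).mul ((hderiv (t - s)).comp_sub_const t s)).mul
    ((hasDerivAt_integral_sub_left hcont t s).const_mul (-γ⁻¹)).exp
  have hint : HasDerivAt (fun σ => ∫ y in (0:ℝ)..σ, K₀ (t - y)) (K₀ (t - s)) s :=
    ((hcont.comp (continuous_const.sub continuous_id)).integral_hasStrictDerivAt 0 s).hasDerivAt
  have hσ := (((hderiv (t - s)).comp_const_sub t s).const_mul ((ρ * γ)⁻¹ * K₀ t)).mul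
    (hint.const_mul (-γ⁻¹)).exp
  refine ⟨hr.differentiableAt, hσ.differentiableAt, ?_, ?_⟩
  · refine (congrArg₂ (· + ·) hr.deriv hσ.deriv).trans ?_
    simp only [Pi.mul_apply]
    ring
  · set E := Real.exp (-γ⁻¹ * ∫ y in (0:ℝ)..s, K₀ (t - y))
    have hloss : 0 ≤ (ρ * γ)⁻¹ * (γ⁻¹ * K₀ t ^ 2) * K₀ (t - s) * E := by
      have := hpos (t - s)
      positivity
    calc (ρ * γ)⁻¹ * (deriv K₀ t - γ⁻¹ * K₀ t ^ 2) * K₀ (t - s) * E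
        ≤ (ρ * γ)⁻¹ * deriv K₀ t * K₀ (t - s) * E := by linarith
      _ = deriv K₀ t / K₀ t * ((ρ * γ)⁻¹ * K₀ t * K₀ (t - s) * E) := by
        field_simp [(hpos t).ne']
end

section
/- Assume in addition that K₀′(t)/K₀(t)² → 0 as t → ∞. Then the function Q(t) := K₀(t) exp(−H(t)/γ) tends to 0 as t → ∞, where H(t) := ∫_0^t K₀(y) dy. -/
open MeasureTheory Set Filter

/-- If `f ≥ β > 0` is continuous, then `exp (-(∫₀ᵗ f) / c) → 0` as `t → ∞` for every `c > 0`. -/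
theorem tendsto_exp_neg_integral_div_atTop {c β : ℝ} (hc : 0 < c) (hβ : 0 < β) {f : ℝ → ℝ}
    (hf : Continuous f) (hfβ : ∀ t, β ≤ f t) :
    Tendsto (fun t => Real.exp (-(∫ y in (0:ℝ)..t, f y) / c)) atTop (nhds 0) := by
  have hH : Tendsto (fun t => ∫ y in (0:ℝ)..t, f y) atTop atTop := by
    refine tendsto_atTop_mono' _ ?_ (tendsto_id.const_mul_atTop hβ)
    filter_upwards [eventually_ge_atTop 0] with t ht
    have h := intervalIntegral.integral_mono_on (μ := volume) ht
      (continuous_const.intervalIntegrable 0 t) (hf.intervalIntegrable 0 t) fun x _ => hfβ x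
    simpa [mul_comm] using h
  simp only [neg_div]
  exact Real.tendsto_exp_neg_atTop_nhds_zero.comp (hH.atTop_div_const hc)

/-- If `f' ≤ f² / c` on `[T, ∞)`, then `t ↦ f t * exp (-(∫₀ᵗ f) / c)` is antitone there. -/
theorem antitoneOn_mul_exp_neg_integral_div {c T : ℝ} {f : ℝ → ℝ} (hf : ContDiff ℝ 1 f)
    (hT : ∀ t, T ≤ t → deriv f t ≤ f t ^ 2 / c) :
    AntitoneOn (fun t => f t * Real.exp (-(∫ y in (0:ℝ)..t, f y) / c)) (Ici T) := by
  have hderiv : ∀ t, HasDerivAt (fun t => f t * Real.exp (-(∫ y in (0:ℝ)..t, f y) / c))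
      (deriv f t * Real.exp (-(∫ y in (0:ℝ)..t, f y) / c)
        + f t * (Real.exp (-(∫ y in (0:ℝ)..t, f y) / c) * (-f t / c))) t := fun t =>
    ((hf.differentiable one_ne_zero) t).hasDerivAt.mul
      (((hf.continuous.integral_hasStrictDerivAt 0 t).hasDerivAt.neg.div_const c).exp)
  refine antitoneOn_of_deriv_nonpos (convex_Ici T)
    (fun t _ => (hderiv t).continuousAt.continuousWithinAt)
    (fun t _ => (hderiv t).differentiableAt.differentiableWithinAt) fun t ht => ?_
  rw [interior_Ici] at ht
  rw [(hderiv t).deriv]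
  have h := mul_nonpos_of_nonpos_of_nonneg (sub_nonpos.2 (hT t ht.le))
    (Real.exp_pos (-(∫ y in (0:ℝ)..t, f y) / c)).le
  refine le_of_eq_of_le ?_ h
  ring

/-- If `K₀'(t)/K₀(t)² → 0` as `t → ∞`, then `Q(t) = K₀(t) exp(−H(t)/γ) → 0`,
where `H(t) = ∫₀ᵗ K₀(y) dy`. -/
theorem aging_kernel_Q_vanishes
    (γ β : ℝ) (hγ : 0 < γ) (hβ : 0 < β)
    (K₀ : ℝ → ℝ) (hK₀C1 : ContDiff ℝ 1 K₀) (hK₀mono : Monotone K₀)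
    (hK₀β : ∀ t : ℝ, β ≤ K₀ t)
    (hK₀' : Tendsto (fun t => deriv K₀ t / (K₀ t) ^ 2) atTop (nhds 0)) :
    Tendsto (fun t => K₀ t * Real.exp (-(∫ y in (0:ℝ)..t, K₀ y) / γ))
      atTop (nhds 0) := by
  have hKc : Continuous K₀ := hK₀C1.continuous
  have hKpos : ∀ t, 0 < K₀ t := fun t => hβ.trans_le (hK₀β t)
  have hE := tendsto_exp_neg_integral_div_atTop (c := 2 * γ) (by positivity) hβ hKc hK₀β
  obtain ⟨T, hT⟩ := eventually_atTop.1 (hK₀'.eventually_le_const (show 0 < 1 / (2 * γ) by positivity))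
  have hanti := antitoneOn_mul_exp_neg_integral_div (c := 2 * γ) (T := T) hK₀C1 fun t ht => by
    have h := (div_le_iff₀ (pow_pos (hKpos t) 2)).1 (hT t ht)
    rwa [one_div_mul_eq_div] at h
  have hbound := hE.const_mul (K₀ T * Real.exp (-(∫ y in (0:ℝ)..T, K₀ y) / (2 * γ)))
  rw [mul_zero] at hbound
  refine squeeze_zero' (.of_forall fun t => (mul_pos (hKpos t) (Real.exp_pos _)).le) ?_ hbound
  filter_upwards [eventually_ge_atTop T] with t ht
  have hsplit : Real.exp (-(∫ y in (0:ℝ)..t, K₀ y) / γ)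
      = Real.exp (-(∫ y in (0:ℝ)..t, K₀ y) / (2 * γ))
        * Real.exp (-(∫ y in (0:ℝ)..t, K₀ y) / (2 * γ)) := by
    rw [← Real.exp_add]
    congr 1
    field_simp
    ring
  rw [hsplit, ← mul_assoc]
  exact mul_le_mul_of_nonneg_right (hanti self_mem_Ici ht ht) (Real.exp_pos _).le
end

section
/- For every t ∈ ℝ one has ∫_t^∞ k_t(s) ds ≤ (γ/(ρβ)) K₀(t) exp(−H(t)/γ), where H(t) := ∫_0^t K₀(y) dy. -/
open MeasureTheory Set Filter

/-- If a continuous `f` is bounded below by `β`, then `s ↦ ∫ y in 0..s, f (t - y)` grows at least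
linearly, with slope `β`, past `t`. -/
lemma integral_add_mul_le_integral_comp_sub {f : ℝ → ℝ} (hf : Continuous f) {β : ℝ}
    (hβ : ∀ x, β ≤ f x) {s t : ℝ} (hst : t ≤ s) :
    (∫ y in (0:ℝ)..t, f y) + β * (s - t) ≤ ∫ y in (0:ℝ)..s, f (t - y) := by
  have hsplit := intervalIntegral.integral_add_adjacent_intervals
    (hf.intervalIntegrable (μ := volume) (t - s) 0) (hf.intervalIntegrable (μ := volume) 0 t)
  have hlower : ∫ _ in (t - s)..(0:ℝ), β ≤ ∫ y in (t - s)..(0:ℝ), f y :=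
    intervalIntegral.integral_mono_on (by linarith) (by simp) (hf.intervalIntegrable _ _)
      fun x _ => hβ x
  rw [intervalIntegral.integral_const, smul_eq_mul] at hlower
  rw [intervalIntegral.integral_comp_sub_left, sub_zero]
  linarith

/-- Tail bound for the aging kernel: for every `t`,
`∫ₜ^∞ k_t(s) ds ≤ (γ/(ρβ)) K₀(t) exp(−H(t)/γ)`, with `H(t) = ∫₀ᵗ K₀(y) dy`. -/
theorem aging_kernel_tail_bound
    (ρ γ β : ℝ) (hρ : 0 < ρ) (hγ : 0 < γ) (hβ : 0 < β)
    (K₀ : ℝ → ℝ) (hK₀C1 : ContDiff ℝ 1 K₀) (hK₀mono : Monotone K₀)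
    (hK₀β : ∀ t : ℝ, β ≤ K₀ t)
    (t : ℝ) :
    IntegrableOn
      (fun s => ρ⁻¹ * K₀ t * Real.exp (-γ⁻¹ * ∫ y in (0:ℝ)..s, K₀ (t - y))) (Ioi t)
    ∧ (∫ s in Ioi t, ρ⁻¹ * K₀ t * Real.exp (-γ⁻¹ * ∫ y in (0:ℝ)..s, K₀ (t - y)))
        ≤ (γ / (ρ * β)) * K₀ t * Real.exp (-(∫ y in (0:ℝ)..t, K₀ y) / γ) := by
  have hK : Continuous K₀ := hK₀C1.continuous
  have hKt : 0 < K₀ t := hβ.trans_le (hK₀β t)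
  have hrate : -(β / γ) < 0 := neg_neg_of_pos (div_pos hβ hγ)
  set H := ∫ y in (0:ℝ)..t, K₀ y
  set C := ρ⁻¹ * K₀ t * Real.exp (-H / γ + β / γ * t) with hC
  have hle : ∀ s ∈ Ioi t, ρ⁻¹ * K₀ t * Real.exp (-γ⁻¹ * ∫ y in (0:ℝ)..s, K₀ (t - y))
      ≤ C * Real.exp (-(β / γ) * s) := by
    intro s hs
    have h := integral_add_mul_le_integral_comp_sub hK hK₀β (le_of_lt hs)
    rw [hC, mul_assoc _ (Real.exp _), ← Real.exp_add]
    gcongr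
    have h' := mul_le_mul_of_nonneg_left h (inv_pos.2 hγ).le
    calc _ ≤ -(γ⁻¹ * (H + β * (s - t))) := by linarith
      _ = _ := by ring
  have hdom : IntegrableOn (fun s => C * Real.exp (-(β / γ) * s)) (Ioi t) :=
    (integrableOn_exp_mul_Ioi hrate t).const_mul C
  have hcont : Continuous fun s : ℝ => ∫ y in (0:ℝ)..s, K₀ (t - y) :=
    intervalIntegral.continuous_primitive
      (fun a b => (hK.comp (continuous_const.sub continuous_id)).intervalIntegrable a b) 0
  have hint : IntegrableOn
      (fun s => ρ⁻¹ * K₀ t * Real.exp (-γ⁻¹ * ∫ y in (0:ℝ)..s, K₀ (t - y))) (Ioi t) := by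
    refine hdom.mono' (by fun_prop) ?_
    filter_upwards [ae_restrict_mem measurableSet_Ioi] with s hs
    rw [Real.norm_of_nonneg (by positivity)]
    exact hle s hs
  refine ⟨hint, (setIntegral_mono_on hint hdom measurableSet_Ioi hle).trans_eq ?_⟩
  rw [integral_const_mul, integral_exp_mul_Ioi hrate, hC, Real.exp_add, neg_mul, Real.exp_neg]
  field_simp
end

section
/- Assume in addition that K₀(t) → ∞ and K₀′(t)/K₀(t)² → 0 as t → ∞. Then for every ν > 0 one has lim_{t→∞} ∫_ν^∞ k_t(s) ds = 0. -/
open MeasureTheory Set Filter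

/-- If `K' ≤ ε K²` on `[a, b]` and `K > 0`, then `log (K b / K a) ≤ ε ∫ K`. -/
lemma log_sub_log_le_integral {K : ℝ → ℝ} (hK : ContDiff ℝ 1 K) (hpos : ∀ x, 0 < K x)
    {a b ε : ℝ} (hab : a ≤ b) (h : ∀ x ∈ Icc a b, deriv K x ≤ ε * K x ^ 2) :
    Real.log (K b) - Real.log (K a) ≤ ε * ∫ x in a..b, K x := by
  have hcont : Continuous fun x => deriv K x / K x :=
    (hK.continuous_deriv le_rfl).div hK.continuous fun x => (hpos x).ne'
  have hderiv : ∀ x ∈ uIcc a b, HasDerivAt (fun x => Real.log (K x)) (deriv K x / K x) x :=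
    fun x _ => ((hK.differentiable one_ne_zero) x).hasDerivAt.log (hpos x).ne'
  rw [← intervalIntegral.integral_eq_sub_of_hasDerivAt hderiv (hcont.intervalIntegrable a b),
    ← intervalIntegral.integral_const_mul]
  refine intervalIntegral.integral_mono_on hab (hcont.intervalIntegrable a b)
    ((continuous_const.mul hK.continuous).intervalIntegrable a b) fun x hx => ?_
  rw [div_le_iff₀ (hpos x)]
  linarith [h x hx, show ε * K x ^ 2 = ε * K x * K x by ring]

/-- A lower bound `β` on `f` bounds the tail of `exp (-c ∫₀ˢ f)` by its value at `ν`. -/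
lemma integral_Ioi_exp_neg_mul_integral_le {f : ℝ → ℝ} (hf : Continuous f) {β c A : ℝ}
    (hβ : 0 < β) (hc : 0 < c) (hA : 0 ≤ A) (hfβ : ∀ x, β ≤ f x) (ν : ℝ) :
    ∫ s in Ioi ν, A * Real.exp (-c * ∫ y in (0:ℝ)..s, f y) ≤
      A * Real.exp (-c * ∫ y in (0:ℝ)..ν, f y) / (c * β) := by
  have hneg : -(c * β) < 0 := neg_lt_zero.mpr (mul_pos hc hβ)
  set B := A * Real.exp (-c * ∫ y in (0:ℝ)..ν, f y) with hB
  have hbound : ∀ s ∈ Ioi ν, A * Real.exp (-c * ∫ y in (0:ℝ)..s, f y) ≤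
      B * Real.exp (c * β * ν) * Real.exp (-(c * β) * s) := by
    intro s hs
    have hsplit := intervalIntegral.integral_add_adjacent_intervals
      (hf.intervalIntegrable (μ := volume) 0 ν) (hf.intervalIntegrable ν s)
    have hlow : β * (s - ν) ≤ ∫ y in ν..s, f y := by
      have := intervalIntegral.integral_mono_on (le_of_lt hs)
        (intervalIntegrable_const (μ := volume) (c := β)) (hf.intervalIntegrable ν s)
        fun x _ => hfβ x
      simpa [mul_comm] using this
    rw [hB, mul_assoc, mul_assoc, ← Real.exp_add, ← Real.exp_add, ← hsplit]
    gcongr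
    nlinarith [mul_le_mul_of_nonneg_left hlow hc.le]
  calc ∫ s in Ioi ν, A * Real.exp (-c * ∫ y in (0:ℝ)..s, f y)
      ≤ ∫ s in Ioi ν, B * Real.exp (c * β * ν) * Real.exp (-(c * β) * s) := by
        refine integral_mono_of_nonneg (Eventually.of_forall fun s => by positivity)
          ((integrableOn_exp_mul_Ioi hneg ν).const_mul _) ?_
        exact (ae_restrict_iff' measurableSet_Ioi).mpr (Eventually.of_forall hbound)
    _ = B / (c * β) := by
        rw [integral_const_mul, integral_exp_mul_Ioi hneg, neg_div_neg_eq, mul_div_assoc',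
          mul_assoc, ← Real.exp_add]
        simp

/-- If `K₀(t) → ∞` and `K₀'(t)/K₀(t)² → 0` as `t → ∞`, then for every `ν > 0` the
tail mass of the aging kernel vanishes: `∫_ν^∞ k_t(s) ds → 0` as `t → ∞`. -/
theorem aging_kernel_tail_vanishes
    (ρ γ β : ℝ) (hρ : 0 < ρ) (hγ : 0 < γ) (hβ : 0 < β)
    (K₀ : ℝ → ℝ) (hK₀C1 : ContDiff ℝ 1 K₀) (hK₀mono : Monotone K₀)
    (hK₀β : ∀ t : ℝ, β ≤ K₀ t)
    (hK₀top : Tendsto K₀ atTop atTop)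
    (hK₀' : Tendsto (fun t => deriv K₀ t / (K₀ t) ^ 2) atTop (nhds 0))
    (ν : ℝ) (hν : 0 < ν) :
    Tendsto
      (fun t => ∫ s in Ioi ν, ρ⁻¹ * K₀ t * Real.exp (-γ⁻¹ * ∫ y in (0:ℝ)..s, K₀ (t - y)))
      atTop (nhds 0) := by
  have hpos : ∀ x, 0 < K₀ x := fun x => hβ.trans_le (hK₀β x)
  have hcont := hK₀C1.continuous
  set b := γ⁻¹ / 2 * ν with hb
  have hbpos : 0 < b := by positivity
  have hlim : Tendsto (fun t => ρ⁻¹ * (K₀ (t - ν) * Real.exp (-b * K₀ (t - ν))) / (γ⁻¹ * β))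
      atTop (nhds 0) := by
    have h₁ : Tendsto (fun x : ℝ => x * Real.exp (-b * x)) atTop (nhds 0) := by
      simpa using tendsto_rpow_mul_exp_neg_mul_atTop_nhds_zero 1 b hbpos
    have h₂ : Tendsto (fun t => K₀ (t - ν)) atTop atTop :=
      hK₀top.comp (tendsto_atTop_add_const_right atTop (-ν) tendsto_id)
    simpa using ((h₁.comp h₂).const_mul ρ⁻¹).div_const (γ⁻¹ * β)
  obtain ⟨T, hT⟩ := eventually_atTop.mp
    (hK₀'.eventually_le_const (show (0:ℝ) < γ⁻¹ / 2 by positivity))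
  refine tendsto_of_tendsto_of_tendsto_of_le_of_le' tendsto_const_nhds hlim
    (Eventually.of_forall fun t => integral_nonneg fun s => ?_) ?_
  · have := hpos t
    positivity
  filter_upwards [eventually_ge_atTop (T + ν)] with t ht
  have hKt := hpos t
  refine (integral_Ioi_exp_neg_mul_integral_le
    (show Continuous fun y => K₀ (t - y) by fun_prop) hβ (inv_pos.mpr hγ) (by positivity) (fun x => hK₀β (t - x)) ν).trans ?_
  have hchange : ∫ y in (0:ℝ)..ν, K₀ (t - y) = ∫ x in (t - ν)..t, K₀ x := by
    simp [intervalIntegral.integral_comp_sub_left]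
  rw [hchange]
  set I := ∫ x in (t - ν)..t, K₀ x with hI
  have hlog : Real.log (K₀ t) - Real.log (K₀ (t - ν)) ≤ γ⁻¹ / 2 * I :=
    log_sub_log_le_integral hK₀C1 hpos (by linarith) fun x hx =>
      (div_le_iff₀ (pow_pos (hpos x) 2)).mp (hT x (by linarith [hx.1]))
  have hlow : ν * K₀ (t - ν) ≤ I := by
    have := intervalIntegral.integral_mono_on (show t - ν ≤ t by linarith)
      (intervalIntegrable_const (μ := volume) (c := K₀ (t - ν)))
      (hcont.intervalIntegrable (t - ν) t) fun x hx => hK₀mono hx.1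
    simpa using this
  have hkey : K₀ t * Real.exp (-γ⁻¹ * I) ≤ K₀ (t - ν) * Real.exp (-b * K₀ (t - ν)) := by
    have hlow' := mul_le_mul_of_nonneg_left hlow (show 0 ≤ γ⁻¹ / 2 by positivity)
    rw [← Real.exp_log hKt, ← Real.exp_log (hpos (t - ν)), ← Real.exp_add, ← Real.exp_add,
      Real.exp_le_exp, Real.exp_log (hpos (t - ν)), hb]
    linarith
  rw [mul_assoc]
  gcongr
end

section
/- Assume in addition that K₀(t) → ∞ and K₀′(t)/K₀(t)² → 0 as t → ∞. Then lim_{t→∞} ∫_0^∞ k_t(s) ds = γ/ρ. Together with the vanishing of ∫_ν^∞ k_t(s) ds for each ν > 0, this means k_t converges distributionally to (γ/ρ)·δ₀ as t → ∞, i.e. the equation with memory collapses into the Kelvin-Voigt model. -/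
open MeasureTheory Set Filter

/-- If `f' ≤ c g'` eventually and `g → ∞`, then `f / g` is eventually below every `d > c`. -/
lemma eventually_div_lt_of_deriv_le {f g f' g' : ℝ → ℝ} {c d : ℝ}
    (hf : ∀ x, HasDerivAt f (f' x) x) (hg : ∀ x, HasDerivAt g (g' x) x)
    (hg_top : Tendsto g atTop atTop) (hle : ∀ᶠ x in atTop, f' x ≤ c * g' x) (hcd : c < d) :
    ∀ᶠ x in atTop, f x / g x < d := by
  obtain ⟨T, hT⟩ := eventually_atTop.1 hle
  have hderiv : ∀ x, HasDerivAt (fun x => f x - c * g x) (f' x - c * g' x) x := fun x =>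
    (hf x).sub ((hg x).const_mul c)
  have hanti : AntitoneOn (fun x => f x - c * g x) (Ici T) := by
    refine antitoneOn_of_deriv_nonpos (convex_Ici T)
      (fun x _ => (hderiv x).continuousAt.continuousWithinAt)
      (fun x _ => (hderiv x).differentiableAt.differentiableWithinAt) fun x hx => ?_
    rw [interior_Ici] at hx
    rw [(hderiv x).deriv]
    linarith [hT x (le_of_lt hx)]
  have hlarge : Tendsto (fun x => (d - c) * g x) atTop atTop :=
    hg_top.const_mul_atTop (sub_pos.2 hcd)
  filter_upwards [eventually_ge_atTop T, hg_top.eventually_gt_atTop 0,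
    hlarge.eventually_gt_atTop (f T - c * g T)] with x hxT hgx hx
  have := hanti self_mem_Ici hxT hxT
  rw [div_lt_iff₀ hgx]
  simp only at this
  linarith

/-- L'Hôpital's rule at infinity for a denominator tending to infinity. -/
lemma tendsto_div_of_tendsto_deriv_div {f g f' g' : ℝ → ℝ} {L : ℝ}
    (hf : ∀ x, HasDerivAt f (f' x) x) (hg : ∀ x, HasDerivAt g (g' x) x)
    (hg_top : Tendsto g atTop atTop) (hg' : ∀ᶠ x in atTop, 0 < g' x)
    (hdiv : Tendsto (fun x => f' x / g' x) atTop (nhds L)) :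
    Tendsto (fun x => f x / g x) atTop (nhds L) := by
  rw [tendsto_order]
  constructor
  · intro a ha
    obtain ⟨c, hac, hcL⟩ := exists_between ha
    have := eventually_div_lt_of_deriv_le (c := -c) (fun x => (hf x).neg) hg hg_top
      (by
        filter_upwards [hg', hdiv.eventually_const_lt hcL] with x hx hlt
        rw [lt_div_iff₀ hx] at hlt
        linarith) (neg_lt_neg hac)
    filter_upwards [this] with x hx
    rw [Pi.neg_apply, neg_div] at hx
    linarith
  · intro d hd
    obtain ⟨c, hLc, hcd⟩ := exists_between hd
    refine eventually_div_lt_of_deriv_le hf hg hg_top ?_ hcd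
    filter_upwards [hg', hdiv.eventually_lt_const hLc] with x hx hlt
    rw [div_lt_iff₀ hx] at hlt
    linarith

/-- A function whose derivative is eventually at least `c > 0` tends to infinity. -/
lemma tendsto_atTop_of_le_deriv {f f' : ℝ → ℝ} {c : ℝ} (hf : ∀ x, HasDerivAt f (f' x) x)
    (hc : 0 < c) (hle : ∀ᶠ x in atTop, c ≤ f' x) : Tendsto f atTop atTop := by
  have hlt := eventually_div_lt_of_deriv_le (c := -c) (d := -(c / 2)) (fun x => (hf x).neg)
    hasDerivAt_id tendsto_id (hle.mono fun x hx => by linarith) (by linarith)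
  refine tendsto_atTop_mono' atTop ?_ (tendsto_id.const_mul_atTop (half_pos hc))
  filter_upwards [hlt, eventually_gt_atTop 0] with x hx hx0
  rw [id, div_lt_iff₀ hx0, Pi.neg_apply] at hx
  rw [id]
  linarith

lemma setIntegral_Ioi_comp_sub_left (f : ℝ → ℝ) (t : ℝ) :
    ∫ s in Ioi (0 : ℝ), f (t - s) = ∫ u in Iic t, f u := by
  rw [integral_Iic_eq_integral_Iio]
  simpa using (Measure.measurePreserving_sub_left volume t).setIntegral_preimage_emb
    (MeasurableEquiv.subLeft t).measurableEmbedding f (Iio t)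

lemma integrableOn_Iic_exp_mul_integral {K : ℝ → ℝ} {a β : ℝ} (ha : 0 < a) (hβ : 0 < β)
    (hK : Continuous K) (hKβ : ∀ t, β ≤ K t) (t : ℝ) :
    IntegrableOn (fun u => Real.exp (a * ∫ y in (0 : ℝ)..u, K y)) (Iic t) := by
  have hcont : Continuous fun u => Real.exp (a * ∫ y in (0 : ℝ)..u, K y) :=
    Real.continuous_exp.comp (continuous_const.mul
      (intervalIntegral.continuous_primitive (fun _ _ => hK.intervalIntegrable _ _) 0))
  have hneg : IntegrableOn (fun u => Real.exp (a * ∫ y in (0 : ℝ)..u, K y)) (Iic 0) := by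
    refine (integrableOn_exp_mul_Iic (mul_pos ha hβ) 0).mono' hcont.aestronglyMeasurable ?_
    filter_upwards [ae_restrict_mem measurableSet_Iic] with u hu
    rw [Real.norm_eq_abs, Real.abs_exp, Real.exp_le_exp, mul_assoc]
    refine mul_le_mul_of_nonneg_left ?_ ha.le
    have := intervalIntegral.integral_mono_on hu (μ := volume)
      (intervalIntegrable_const (c := β)) (hK.intervalIntegrable u 0) fun y _ => hKβ y
    rw [intervalIntegral.integral_const, smul_eq_mul] at this
    rw [intervalIntegral.integral_symm]
    linarith
  exact (hneg.union (hcont.integrableOn_Icc (a := 0) (b := t))).mono_set fun u hu => by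
    rcases le_total u 0 with h | h
    · exact Or.inl h
    · exact Or.inr ⟨h, hu⟩

lemma hasDerivAt_integral_Iic {f : ℝ → ℝ} (hf : Continuous f)
    (hint : ∀ t, IntegrableOn f (Iic t)) (t : ℝ) :
    HasDerivAt (fun t => ∫ u in Iic t, f u) (f t) t := by
  have heq : (fun t => ∫ u in Iic t, f u) =
      fun t => (∫ u in (0 : ℝ)..t, f u) + ∫ u in Iic 0, f u := by
    funext t
    rw [← intervalIntegral.integral_Iic_sub_Iic (hint 0) (hint t), sub_add_cancel]
  rw [heq]
  exact (hf.integral_hasStrictDerivAt 0 t).hasDerivAt.add_const _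

lemma integral_aging_kernel_eq {K : ℝ → ℝ} (hK : Continuous K) (ρ a t : ℝ) :
    ∫ s in Ioi (0 : ℝ), ρ⁻¹ * K t * Real.exp (-a * ∫ y in (0 : ℝ)..s, K (t - y)) =
      ρ⁻¹ * ((∫ u in Iic t, Real.exp (a * ∫ y in (0 : ℝ)..u, K y)) /
        (Real.exp (a * ∫ y in (0 : ℝ)..t, K y) / K t)) := by
  have hint : ∀ s, Real.exp (-a * ∫ y in (0 : ℝ)..s, K (t - y)) =
      Real.exp (a * ∫ y in (0 : ℝ)..(t - s), K y) / Real.exp (a * ∫ y in (0 : ℝ)..t, K y) := by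
    intro s
    rw [intervalIntegral.integral_comp_sub_left, sub_zero, ← Real.exp_sub,
      ← intervalIntegral.integral_interval_sub_left (hK.intervalIntegrable 0 t)
        (hK.intervalIntegrable 0 (t - s))]
    congr 1
    ring
  simp_rw [hint]
  rw [integral_const_mul, integral_div,
    setIntegral_Ioi_comp_sub_left (fun u => Real.exp (a * ∫ y in (0 : ℝ)..u, K y)),
    div_div_eq_mul_div]
  ring

/-- If `K₀(t) → ∞` and `K₀'(t)/K₀(t)² → 0` as `t → ∞`, then the total mass of the
aging kernel converges to `γ/ρ`: `∫₀^∞ k_t(s) ds → γ/ρ` as `t → ∞`; hence `k_t`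
converges distributionally to `(γ/ρ)·δ₀`, i.e. the equation with memory collapses
into the Kelvin-Voigt model. -/
theorem aging_kernel_mass_to_KelvinVoigt
    (ρ γ β : ℝ) (hρ : 0 < ρ) (hγ : 0 < γ) (hβ : 0 < β)
    (K₀ : ℝ → ℝ) (hK₀C1 : ContDiff ℝ 1 K₀) (hK₀mono : Monotone K₀)
    (hK₀β : ∀ t : ℝ, β ≤ K₀ t)
    (hK₀top : Tendsto K₀ atTop atTop)
    (hK₀' : Tendsto (fun t => deriv K₀ t / (K₀ t) ^ 2) atTop (nhds 0)) :
    Tendsto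
      (fun t => ∫ s in Ioi (0:ℝ), ρ⁻¹ * K₀ t * Real.exp (-γ⁻¹ * ∫ y in (0:ℝ)..s, K₀ (t - y)))
      atTop (nhds (γ / ρ)) := by
  have hcont : Continuous K₀ := hK₀C1.continuous
  have hpos : ∀ t, 0 < K₀ t := fun t => hβ.trans_le (hK₀β t)
  have ha : 0 < γ⁻¹ := inv_pos.2 hγ
  let E : ℝ → ℝ := fun u => Real.exp (γ⁻¹ * ∫ y in (0 : ℝ)..u, K₀ y)
  have hE_deriv : ∀ t, HasDerivAt E (E t * (γ⁻¹ * K₀ t)) t := fun t =>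
    ((hcont.integral_hasStrictDerivAt 0 t).hasDerivAt.const_mul γ⁻¹).exp
  have hE_cont : Continuous E :=
    continuous_iff_continuousAt.2 fun t => (hE_deriv t).continuousAt
  have hG_deriv : ∀ t, HasDerivAt (fun t => E t / K₀ t)
      (E t * (γ⁻¹ - deriv K₀ t / K₀ t ^ 2)) t := fun t => by
    have hne := (hpos t).ne'
    refine ((hE_deriv t).div (hK₀C1.differentiable one_ne_zero t).hasDerivAt hne).congr_deriv ?_
    field_simp
  have hsub : Tendsto (fun t => γ⁻¹ - deriv K₀ t / K₀ t ^ 2) atTop (nhds γ⁻¹) := by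
    simpa using hK₀'.const_sub γ⁻¹
  have hhalf := hsub.eventually_const_lt (half_lt_self ha)
  have hG_top : Tendsto (fun t => E t / K₀ t) atTop atTop := by
    refine tendsto_atTop_of_le_deriv hG_deriv (half_pos ha) ?_
    filter_upwards [hhalf, eventually_ge_atTop 0] with t ht ht0
    have hE1 : 1 ≤ E t := Real.one_le_exp
      (mul_nonneg ha.le (intervalIntegral.integral_nonneg ht0 fun y _ => (hpos y).le))
    nlinarith
  have hlim : Tendsto (fun t => (∫ u in Iic t, E u) / (E t / K₀ t)) atTop (nhds γ) := by
    refine tendsto_div_of_tendsto_deriv_div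
      (hasDerivAt_integral_Iic hE_cont (integrableOn_Iic_exp_mul_integral ha hβ hcont hK₀β))
      hG_deriv hG_top ?_ ?_
    · filter_upwards [hhalf] with t ht
      exact mul_pos (Real.exp_pos _) ((half_pos ha).trans ht)
    · have hinv := hsub.inv₀ ha.ne'
      rw [inv_inv] at hinv
      refine hinv.congr fun t => ?_
      rw [div_mul_cancel_left₀ (Real.exp_pos _).ne']
  simp_rw [integral_aging_kernel_eq hcont]
  rw [div_eq_inv_mul]
  exact hlim.const_mul ρ⁻¹
end
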